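/- Let R be a commutative ring, A and B be R-projective R-algebras, and let P(A) → A and P(B) → B be projective resolutions over A^e = A⊗A^op and B^e respectively. Then the total complex P(A)⊗P(B) → A⊗B is a projective resolution of A⊗B over (A⊗B)^e. -/

import Mathlib

open TensorProduct DirectSum

noncomputable section

variable (R : Type) [CommRing R]

/-- The enveloping algebra `C^e = C ⊗_R C^op` of an `R`-algebra `C`. -/
abbrev Env (C : Type) [Ring C] [Algebra R C] : Type := C ⊗[R] Cᵐᵒᵖ

/-- A `C`-bimodule is a module over the enveloping algebra; in particular `C` itself is. -/
local instance envModule (C : Type) [Ring C] [Algebra R C] : Module (Env R C) C :=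
  TensorProduct.Algebra.module

/-- Index set for the degree-`n` component of a total complex. -/
abbrev TotIdx (n : ℕ) : Type := {ij : ℕ × ℕ // ij.1 + ij.2 = n}

theorem lift_exact {N X Y Z : Type} [AddCommGroup N] [Module R N] [AddCommGroup X] [Module R X]
    [AddCommGroup Y] [Module R Y] [AddCommGroup Z] [Module R Z] [Module.Projective R N]
    (d : X →ₗ[R] Y) (g : Y →ₗ[R] Z) (hex : Function.Exact d g) (f : N →ₗ[R] Y)
    (h : ∀ x, g (f x) = 0) : ∃ s : N →ₗ[R] X, ∀ x, d (s x) = f x := by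
  have hf : ∀ x, f x ∈ LinearMap.range d := fun x => by
    obtain ⟨y, hy⟩ := (hex (f x)).1 (h x)
    exact ⟨y, hy⟩
  obtain ⟨s, hs⟩ := Module.projective_lifting_property d.rangeRestrict
    (f.codRestrict (LinearMap.range d) hf) d.surjective_rangeRestrict
  refine ⟨s, fun x => ?_⟩
  have := congrArg Subtype.val (LinearMap.congr_fun hs x)
  simpa using this

theorem exists_contraction (X : ℕ → Type) [∀ n, AddCommGroup (X n)] [∀ n, Module R (X n)]
    (M : Type) [AddCommGroup M] [Module R M]
    (hX : ∀ n, Module.Projective R (X n)) (hM : Module.Projective R M)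
    (d : ∀ n, X (n + 1) →ₗ[R] X n) (ε : X 0 →ₗ[R] M) (hs : Function.Surjective ε)
    (h0 : Function.Exact (d 0) ε) (h1 : ∀ n, Function.Exact (d (n + 1)) (d n)) :
    ∃ (σ : M →ₗ[R] X 0) (s : ∀ n, X n →ₗ[R] X (n + 1)),
      (∀ m, ε (σ m) = m) ∧ (∀ x, d 0 (s 0 x) = x - σ (ε x)) ∧
      (∀ n x, d (n + 1) (s (n + 1) x) = x - s n (d n x)) := by
  obtain ⟨σ, hσ⟩ := Module.projective_lifting_property ε LinearMap.id hs
  have hσ' : ∀ m, ε (σ m) = m := fun m => LinearMap.congr_fun hσ m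
  obtain ⟨s0, hs0⟩ := lift_exact R (d 0) ε h0 (LinearMap.id - σ ∘ₗ ε) (by
    intro x; simp [hσ'])
  have step : ∀ n, ∀ s : {s : X n →ₗ[R] X (n + 1) // ∀ x, d n (s (d n x)) = d n x},
      ∃ s' : {s : X (n + 1) →ₗ[R] X (n + 1 + 1) // ∀ x, d (n + 1) (s (d (n + 1) x)) = d (n + 1) x},
        ∀ x, d (n + 1) (s'.1 x) = x - s.1 (d n x) := by
    intro n s
    obtain ⟨s', hs'⟩ := lift_exact R (d (n + 1)) (d n) (h1 n) (LinearMap.id - s.1 ∘ₗ d n) (by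
      intro x; simp [s.2])
    have hs'' : ∀ x, d (n + 1) (s' x) = x - s.1 (d n x) := fun x => by simpa using hs' x
    refine ⟨⟨s', fun x => ?_⟩, hs''⟩
    rw [hs'', (h1 n).apply_apply_eq_zero]; simp
  choose nxt hnxt using step
  let S : ∀ n, {s : X n →ₗ[R] X (n + 1) // ∀ x, d n (s (d n x)) = d n x} := fun n =>
    Nat.rec ⟨s0, fun x => by
      rw [hs0]; simp [h0.apply_apply_eq_zero]⟩ (fun n s => nxt n s) n
  refine ⟨σ, fun n => (S n).1, hσ', fun x => hs0 x, fun n x => ?_⟩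
  exact hnxt n (S n) x

section Tot
variable (X Y : ℕ → Type) [∀ n, AddCommGroup (X n)] [∀ n, Module R (X n)]
   [∀ n, AddCommGroup (Y n)] [∀ n, Module R (Y n)]

abbrev TotM (n : ℕ) : Type := ⨁ (ij : TotIdx n), (X ij.1.1 ⊗[R] Y ij.1.2)

def inc (n i j : ℕ) (h : i + j = n) : X i ⊗[R] Y j →ₗ[R] TotM R X Y n :=
  DirectSum.lof R (TotIdx n) (fun ij : TotIdx n => X ij.1.1 ⊗[R] Y ij.1.2) ⟨(i, j), h⟩

theorem of_eq_inc (n i j : ℕ) (h : i + j = n) (z : X i ⊗[R] Y j) :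
    DirectSum.of (fun ij : TotIdx n => X ij.1.1 ⊗[R] Y ij.1.2) ⟨(i, j), h⟩ z = inc R X Y n i j h z :=
  rfl

theorem tot_ext {n : ℕ} {W : Type} [AddCommGroup W] [Module R W] {f g : TotM R X Y n →ₗ[R] W}
    (h : ∀ i j (hij : i + j = n) (x : X i) (y : Y j),
      f (inc R X Y n i j hij (x ⊗ₜ y)) = g (inc R X Y n i j hij (x ⊗ₜ y))) : f = g := by
  refine DirectSum.linearMap_ext R fun ij => ?_
  obtain ⟨⟨i, j⟩, hij⟩ := ij
  refine TensorProduct.ext' fun x y => h i j hij x y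

/-- Extension of linear maps from components. -/
def totLift {n : ℕ} {W : Type} [AddCommMonoid W] [Module R W]
    (f : ∀ i j, i + j = n → (X i ⊗[R] Y j →ₗ[R] W)) : TotM R X Y n →ₗ[R] W :=
  DirectSum.toModule R (TotIdx n) W (fun ij => f ij.1.1 ij.1.2 ij.2)

theorem totLift_inc {n : ℕ} {W : Type} [AddCommMonoid W] [Module R W]
    (f : ∀ i j, i + j = n → (X i ⊗[R] Y j →ₗ[R] W)) (i j : ℕ) (h : i + j = n) (z) :
    totLift R X Y f (inc R X Y n i j h z) = f i j h z :=
  DirectSum.toModule_lof R _ _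

variable {M N : Type} [AddCommGroup M] [Module R M] [AddCommGroup N] [Module R N]

def hcomp (n : ℕ) (e : X 0 →ₗ[R] X 0) (s : ∀ n, X n →ₗ[R] X (n + 1))
    (u : ∀ n, Y n →ₗ[R] Y (n + 1)) :
    ∀ i j, i + j = n → (X i ⊗[R] Y j →ₗ[R] TotM R X Y (n + 1))
  | 0, j, h => inc R X Y (n + 1) 1 j (by omega) ∘ₗ TensorProduct.map (s 0) LinearMap.id
      + inc R X Y (n + 1) 0 (j + 1) (by omega) ∘ₗ TensorProduct.map e (u j)
  | (i + 1), j, h => inc R X Y (n + 1) (i + 2) j (by omega) ∘ₗ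
      TensorProduct.map (s (i + 1)) LinearMap.id

theorem tot_exact (hM : Module.Projective R M) (hN : Module.Projective R N)
    (hX : ∀ n, Module.Projective R (X n)) (hY : ∀ n, Module.Projective R (Y n))
    (d : ∀ n, X (n + 1) →ₗ[R] X n) (ε : X 0 →ₗ[R] M) (hs : Function.Surjective ε)
    (h0 : Function.Exact (d 0) ε) (h1 : ∀ n, Function.Exact (d (n + 1)) (d n))
    (d' : ∀ n, Y (n + 1) →ₗ[R] Y n) (ε' : Y 0 →ₗ[R] N) (hs' : Function.Surjective ε')
    (h0' : Function.Exact (d' 0) ε') (h1' : ∀ n, Function.Exact (d' (n + 1)) (d' n))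
    (D : ∀ n, TotM R X Y (n + 1) →ₗ[R] TotM R X Y n)
    (E : TotM R X Y 0 →ₗ[R] M ⊗[R] N)
    (hD : ∀ (n i j : ℕ) (h : (i + 1) + (j + 1) = n + 1) (p : X (i + 1)) (q : Y (j + 1)),
      D n (inc R X Y _ (i + 1) (j + 1) h (p ⊗ₜ q)) =
        inc R X Y n i (j + 1) (by omega) (d i p ⊗ₜ q)
        + ((-1 : ℤ) ^ (i + 1)) • inc R X Y n (i + 1) j (by omega) (p ⊗ₜ d' j q))
    (hD0 : ∀ (n j : ℕ) (h : 0 + (j + 1) = n + 1) (p : X 0) (q : Y (j + 1)),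
      D n (inc R X Y _ 0 (j + 1) h (p ⊗ₜ q)) =
        inc R X Y n 0 j (by omega) (p ⊗ₜ d' j q))
    (hDn : ∀ (n i : ℕ) (h : (i + 1) + 0 = n + 1) (p : X (i + 1)) (q : Y 0),
      D n (inc R X Y _ (i + 1) 0 h (p ⊗ₜ q)) =
        inc R X Y n i 0 (by omega) (d i p ⊗ₜ q))
    (hE : ∀ (p : X 0) (q : Y 0), E (inc R X Y 0 0 0 rfl (p ⊗ₜ q)) = ε p ⊗ₜ ε' q) :
    Function.Surjective E ∧ Function.Exact (D 0) E ∧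
      ∀ n, Function.Exact (D (n + 1)) (D n) := by
  obtain ⟨σ, s, hσ, hs0, hsn⟩ := exists_contraction R X M hX hM d ε hs h0 h1
  obtain ⟨τ, u, hτ, hu0, hun⟩ := exists_contraction R Y N hY hN d' ε' hs' h0' h1'
  have dd : ∀ n x, d n (d (n + 1) x) = 0 := fun n x => (h1 n).apply_apply_eq_zero x
  have dd' : ∀ n x, d' n (d' (n + 1) x) = 0 := fun n x => (h1' n).apply_apply_eq_zero x
  have ed : ∀ x, ε (d 0 x) = 0 := fun x => h0.apply_apply_eq_zero x
  have ed' : ∀ x, ε' (d' 0 x) = 0 := fun x => h0'.apply_apply_eq_zero x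
  let H : ∀ n, TotM R X Y n →ₗ[R] TotM R X Y (n + 1) := fun n =>
    totLift R X Y (hcomp R X Y n (σ ∘ₗ ε) s u)
  have H0 : ∀ n j (h : 0 + j = n) (p : X 0) (q : Y j), H n (inc R X Y n 0 j h (p ⊗ₜ q)) =
      inc R X Y (n + 1) 1 j (by omega) (s 0 p ⊗ₜ q)
      + inc R X Y (n + 1) 0 (j + 1) (by omega) (σ (ε p) ⊗ₜ u j q) := by
    intro n j h p q
    simp only [H, totLift_inc]; rfl
  have H1 : ∀ n i j (h : (i + 1) + j = n) (p : X (i + 1)) (q : Y j),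
      H n (inc R X Y n (i + 1) j h (p ⊗ₜ q)) =
      inc R X Y (n + 1) (i + 1 + 1) j (by omega) (s (i + 1) p ⊗ₜ q) := by
    intro n i j h p q
    simp only [H, totLift_inc]; rfl
  let E' : M ⊗[R] N →ₗ[R] TotM R X Y 0 := inc R X Y 0 0 0 rfl ∘ₗ TensorProduct.map σ τ
  have hEE : E ∘ₗ E' = LinearMap.id := by
    refine TensorProduct.ext' fun x y => ?_
    simp [E', hE, hσ, hτ]
  have hED : E ∘ₗ D 0 = 0 := by
    refine tot_ext R X Y fun i j hij x y => ?_
    obtain ⟨rfl, rfl⟩ | ⟨rfl, rfl⟩ : (i = 0 ∧ j = 1) ∨ (i = 1 ∧ j = 0) := by omega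
    · simp [hD0, hE, ed']
    · simp [hDn, hE, ed]
  have hDD : ∀ n, D n ∘ₗ D (n + 1) = 0 := by
    intro n
    refine tot_ext R X Y fun i j hij x y => ?_
    rcases i with _ | _ | i <;> rcases j with _ | _ | j <;> (try omega) <;>
      simp [hD, hD0, hDn, dd, dd', pow_succ]
  have hDH0 : D 0 ∘ₗ H 0 + E' ∘ₗ E = LinearMap.id := by
    refine tot_ext R X Y fun i j hij x y => ?_
    obtain ⟨rfl, rfl⟩ : i = 0 ∧ j = 0 := by omega
    simp [H0, hD0, hDn, hE, hs0, hu0, E', sub_tmul, tmul_sub]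
  have hDH : ∀ n, D (n + 1) ∘ₗ H (n + 1) + H n ∘ₗ D n = LinearMap.id := by
    intro n
    refine tot_ext R X Y fun i j hij x y => ?_
    rcases i with _ | _ | i <;> rcases j with _ | j <;> (try omega) <;>
      simp [H0, H1, hD, hD0, hDn, hs0, hsn, hun, ed, sub_tmul, tmul_sub, pow_succ] <;> abel
  refine ⟨fun z => ⟨E' z, LinearMap.congr_fun hEE z⟩, fun z => ⟨fun hz => ⟨H 0 z, ?_⟩, ?_⟩,
    fun n z => ⟨fun hz => ⟨H (n + 1) z, ?_⟩, ?_⟩⟩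
  · simpa [hz] using LinearMap.congr_fun hDH0 z
  · rintro ⟨w, rfl⟩; exact LinearMap.congr_fun hED w
  · simpa [hz] using LinearMap.congr_fun (hDH n) z
  · rintro ⟨w, rfl⟩; exact LinearMap.congr_fun (hDD n) w

end Tot

theorem proj_restrict (S : Type) [Ring S] [Algebra R S] [Module.Projective R S]
    (X : Type) [AddCommGroup X] [Module S X] [Module R X] [IsScalarTower R S X]
    (h : Module.Projective S X) : Module.Projective R X := by
  obtain ⟨s, hs⟩ := (Module.projective_def' (R := S) (P := X)).1 h
  classical
  have : Module.Projective R (X →₀ S) :=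
    Module.Projective.of_equiv (finsuppLEquivDirectSum R S X).symm
  refine Module.Projective.of_split (M := X →₀ S) (s.restrictScalars R)
    ((Finsupp.linearCombination S id).restrictScalars R) ?_
  ext x
  exact LinearMap.congr_fun hs x

theorem env_tower (C : Type) [Ring C] [Algebra R C] : IsScalarTower R (Env R C) C := by
  refine ⟨fun r u x => ?_⟩
  change TensorProduct.Algebra.moduleAux (r • u) x = r • TensorProduct.Algebra.moduleAux u x
  rw [map_smul]; rfl

theorem env_proj (C : Type) [Ring C] [Algebra R C] (h : Module.Projective R C) :
    Module.Projective R (Env R C) := by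
  have : Module.Projective R Cᵐᵒᵖ := Module.Projective.of_equiv (MulOpposite.opLinearEquiv R)
  infer_instance

theorem ring_zero_smul {S X : Type} [Ring S] [AddCommGroup X] [Module S X] (x : X) :
    (0 : S) • x = 0 := zero_smul S x

section Proj
variable (A B : Type) [Ring A] [Algebra R A] [Ring B] [Algebra R B]

def envIso : Env R A ⊗[R] Env R B ≃ₐ[R] Env R (A ⊗[R] B) :=
  (Algebra.TensorProduct.tensorTensorTensorComm R R R R A Aᵐᵒᵖ B Bᵐᵒᵖ).trans
    (Algebra.TensorProduct.congr AlgEquiv.refl (Algebra.TensorProduct.opAlgEquiv R R A B))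

theorem envIso_tmul (a a₂ : A) (b b₂ : B) :
    envIso R A B ((a ⊗ₜ MulOpposite.op a₂) ⊗ₜ (b ⊗ₜ MulOpposite.op b₂)) =
      (a ⊗ₜ b) ⊗ₜ MulOpposite.op (a₂ ⊗ₜ b₂) := by
  simp [envIso]

/-- combine coefficients -/
def comb (X Y I : Type) (k : X × Y → I) :
    (X →₀ Env R A) ⊗[R] (Y →₀ Env R B) →ₗ[R] (I →₀ Env R (A ⊗[R] B)) :=
  Finsupp.lmapDomain _ R k ∘ₗ Finsupp.mapRange.linearMap (envIso R A B).toLinearMap ∘ₗ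
    (finsuppTensorFinsupp R R (Env R A) (Env R B) X Y).toLinearMap

theorem comb_single (X Y I : Type) (k : X × Y → I) (x : X) (y : Y) (u : Env R A) (v : Env R B) :
    comb R A B X Y I k (Finsupp.single x u ⊗ₜ Finsupp.single y v) =
      Finsupp.single (k (x, y)) (envIso R A B (u ⊗ₜ v)) := by
  simp [comb, Finsupp.mapDomain_single]

theorem comb_smul (X Y I : Type) (k : X × Y → I) (u : Env R A) (v : Env R B)
    (f : X →₀ Env R A) (g : Y →₀ Env R B) :
    comb R A B X Y I k ((u • f) ⊗ₜ (v • g)) =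
      envIso R A B (u ⊗ₜ v) • comb R A B X Y I k (f ⊗ₜ g) := by
  induction f using Finsupp.induction_linear with
  | zero => simp
  | add f f' hf hf' => simp only [smul_add, add_tmul, map_add, hf, hf']
  | single x a =>
    induction g using Finsupp.induction_linear with
    | zero => simp
    | add f f' hf hf' => simp only [smul_add, tmul_add, map_add, hf, hf']
    | single y b =>
      simp only [Finsupp.smul_single, comb_single, smul_eq_mul]
      rw [← map_mul, Algebra.TensorProduct.tmul_mul_tmul]

theorem tot_proj (P Q : ℕ → Type) [∀ n, AddCommGroup (P n)] [∀ n, Module (Env R A) (P n)]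
    [∀ n, Module R (P n)] [∀ n, IsScalarTower R (Env R A) (P n)]
    (hP : ∀ n, Module.Projective (Env R A) (P n))
    [∀ n, AddCommGroup (Q n)] [∀ n, Module (Env R B) (Q n)]
    [∀ n, Module R (Q n)] [∀ n, IsScalarTower R (Env R B) (Q n)]
    (hQ : ∀ n, Module.Projective (Env R B) (Q n)) (n : ℕ)
    (T : Type) [AddCommGroup T] [Module (Env R (A ⊗[R] B)) T] [Module R T]
    [IsScalarTower R (Env R (A ⊗[R] B)) T] (t : T ≃ₗ[R] TotM R P Q n)
    (hact : ∀ (i j : ℕ) (h : i + j = n) (p : P i) (q : Q j) (a : A) (b : B)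
        (a₂ : A) (b₂ : B),
      (((a ⊗ₜ[R] b) ⊗ₜ[R] (MulOpposite.op (a₂ ⊗ₜ[R] b₂)) : Env R (A ⊗[R] B)) •
          (t.symm (inc R P Q n i j h (p ⊗ₜ[R] q))))
        = t.symm (inc R P Q n i j h
            ((((a ⊗ₜ[R] MulOpposite.op a₂ : Env R A) • p) : P i)
              ⊗ₜ[R] (((b ⊗ₜ[R] MulOpposite.op b₂ : Env R B) • q) : Q j)))) :
    Module.Projective (Env R (A ⊗[R] B)) T := by
  have key : ∀ (i j : ℕ) (h : i + j = n) (p : P i) (q : Q j) (u : Env R A) (v : Env R B),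
      envIso R A B (u ⊗ₜ v) • t.symm (inc R P Q n i j h (p ⊗ₜ[R] q)) =
        t.symm (inc R P Q n i j h ((u • p) ⊗ₜ (v • q))) := by
    intro i j h p q u v
    induction u using TensorProduct.induction_on with
    | zero =>
      rw [zero_tmul, map_zero]
      refine (ring_zero_smul (S := Env R (A ⊗[R] B)) _).trans ?_
      erw [ring_zero_smul (S := Env R A) p]
      simp
    | add u u' hu hu' => simp only [add_tmul, map_add, add_smul, hu, hu']
    | tmul a a₂ =>
      induction v using TensorProduct.induction_on with
      | zero =>
        rw [tmul_zero, map_zero]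
        refine (ring_zero_smul (S := Env R (A ⊗[R] B)) _).trans ?_
        erw [ring_zero_smul (S := Env R B) q]
        simp
      | add u u' hu hu' => simp only [tmul_add, map_add, add_smul, hu, hu']
      | tmul b b₂ =>
        have := envIso_tmul R A B a a₂.unop b b₂.unop
        simp only [MulOpposite.op_unop] at this
        rw [this, hact]; rfl
  choose uP huP using fun i => (Module.projective_def' (R := Env R A) (P := P i)).1 (hP i)
  choose uQ huQ using fun i => (Module.projective_def' (R := Env R B) (P := Q i)).1 (hQ i)
  let I : Type := Σ ij : TotIdx n, P ij.1.1 × Q ij.1.2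
  let G : ∀ i j, i + j = n → (P i ⊗[R] Q j →ₗ[R] (I →₀ Env R (A ⊗[R] B))) := fun i j h =>
    comb R A B (P i) (Q j) I (fun z => ⟨⟨(i, j), h⟩, z⟩) ∘ₗ
      TensorProduct.map ((uP i).restrictScalars R) ((uQ j).restrictScalars R)
  let F : T →ₗ[R] (I →₀ Env R (A ⊗[R] B)) := totLift R P Q G ∘ₗ t.toLinearMap
  have hF : ∀ (i j : ℕ) (h : i + j = n) (p : P i) (q : Q j),
      F (t.symm (inc R P Q n i j h (p ⊗ₜ[R] q))) =
        comb R A B (P i) (Q j) I (fun z => ⟨⟨(i, j), h⟩, z⟩) (uP i p ⊗ₜ uQ j q) := by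
    intro i j h p q
    simp [F, totLift_inc, G]
  -- induction principle on T
  have ind : ∀ (C : T → Prop) (h0 : C 0) (ha : ∀ x y, C x → C y → C (x + y))
      (hi : ∀ i j (h : i + j = n) (p : P i) (q : Q j), C (t.symm (inc R P Q n i j h (p ⊗ₜ q)))) x,
      C x := by
    intro C h0 ha hi x
    obtain ⟨z, rfl⟩ := t.symm.surjective x
    induction z using DirectSum.induction_on with
    | zero => simpa using h0
    | add x y hx hy => rw [map_add]; exact ha _ _ hx hy
    | of ij z =>
      obtain ⟨⟨i, j⟩, h⟩ := ij
      rw [of_eq_inc]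
      induction z using TensorProduct.induction_on with
      | zero => simpa using h0
      | add x y hx hy => rw [map_add, map_add]; exact ha _ _ hx hy
      | tmul p q => exact hi _ _ _ _ _
  have hFs : ∀ (c : Env R (A ⊗[R] B)) (x : T), F (c • x) = c • F x := by
    intro c x
    obtain ⟨w, rfl⟩ := (envIso R A B).surjective c
    induction w using TensorProduct.induction_on with
    | zero =>
      rw [map_zero]
      have e1 : (0 : Env R (A ⊗[R] B)) • x = 0 := ring_zero_smul x
      have e2 : (0 : Env R (A ⊗[R] B)) • F x = 0 := ring_zero_smul (F x)
      rw [e1, e2, map_zero]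
    | add u u' hu hu' => simp only [map_add, add_smul, hu, hu']
    | tmul u v =>
      induction x using ind with
      | h0 => simp
      | ha x y hx hy => simp only [smul_add, map_add, hx, hy]
      | hi i j h p q => rw [key, hF, hF, map_smul, map_smul, comb_smul]
  let F' : T →ₗ[Env R (A ⊗[R] B)] (I →₀ Env R (A ⊗[R] B)) :=
    { toFun := F, map_add' := F.map_add, map_smul' := hFs }
  let L : (I →₀ Env R (A ⊗[R] B)) →ₗ[Env R (A ⊗[R] B)] T :=
    Finsupp.linearCombination _ (fun k : I =>
      t.symm (inc R P Q n k.1.1.1 k.1.1.2 k.1.2 (k.2.1 ⊗ₜ k.2.2)))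
  have hL : ∀ i j (h : i + j = n) (f : P i →₀ Env R A) (g : Q j →₀ Env R B),
      L (comb R A B (P i) (Q j) I (fun z => ⟨⟨(i, j), h⟩, z⟩) (f ⊗ₜ g)) =
      t.symm (inc R P Q n i j h
        (Finsupp.linearCombination (Env R A) id f ⊗ₜ Finsupp.linearCombination (Env R B) id g)) := by
    intro i j h f g
    induction f using Finsupp.induction_linear with
    | zero => simp
    | add f f' hf hf' => simp only [add_tmul, map_add, hf, hf']
    | single x a =>
      induction g using Finsupp.induction_linear with
      | zero => simp
      | add f f' hf hf' => simp only [tmul_add, map_add, hf, hf']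
      | single y b =>
        rw [comb_single]
        simp only [L, Finsupp.linearCombination_single, id]
        exact key _ _ _ _ _ _ _
  refine Module.Projective.of_split F' L ?_
  ext x
  change L (F x) = x
  induction x using ind with
  | h0 => simp
  | ha x y hx hy => rw [map_add, map_add, hx, hy]
  | hi i j h p q =>
    rw [hF, hL]
    have e1 : Finsupp.linearCombination (Env R A) id (uP i p) = p := LinearMap.congr_fun (huP i) p
    have e2 : Finsupp.linearCombination (Env R B) id (uQ j q) = q := LinearMap.congr_fun (huQ j) q
    rw [e1, e2]

end Proj

/-
STATEMENT 13: Let R be a commutative ring, A and B R-projective R-algebras, and let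
P(A) → A and P(B) → B be projective resolutions over A^e = A⊗A^op and B^e respectively.
Then the total complex P(A)⊗P(B) → A⊗B is a projective resolution of A⊗B over (A⊗B)^e.

Below, `T` is the total complex: a complex of `(A⊗B)^e`-modules together with
`R`-linear identifications `t n : T n ≅ ⨁_{i+j=n} P i ⊗_R Q j` under which the
`(A⊗B)^e ≅ A^e ⊗ B^e`-action is the componentwise one and the differential is the
standard total differential `d⊗1 + (−1)^deg 1⊗d`.  The conclusion is that `T → A⊗B`
is exact (a resolution) and each `T n` is projective over `(A⊗B)^e`.
-/
theorem tensor_product_of_projective_resolutions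
    (A B : Type) [Ring A] [Algebra R A] [Ring B] [Algebra R B]
    (hRA : Module.Projective R A) (hRB : Module.Projective R B)
    -- a projective resolution P → A over A^e
    (P : ℕ → Type) [∀ n, AddCommGroup (P n)] [∀ n, Module (Env R A) (P n)]
    [∀ n, Module R (P n)] [∀ n, IsScalarTower R (Env R A) (P n)]
    (dP : ∀ n, P (n + 1) →ₗ[Env R A] P n) (εP : P 0 →ₗ[Env R A] A)
    (hPproj : ∀ n, Module.Projective (Env R A) (P n))
    (hPsurj : Function.Surjective εP)
    (hPexact0 : Function.Exact (dP 0) εP)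
    (hPexact : ∀ n, Function.Exact (dP (n + 1)) (dP n))
    -- a projective resolution Q → B over B^e
    (Q : ℕ → Type) [∀ n, AddCommGroup (Q n)] [∀ n, Module (Env R B) (Q n)]
    [∀ n, Module R (Q n)] [∀ n, IsScalarTower R (Env R B) (Q n)]
    (dQ : ∀ n, Q (n + 1) →ₗ[Env R B] Q n) (εQ : Q 0 →ₗ[Env R B] B)
    (hQproj : ∀ n, Module.Projective (Env R B) (Q n))
    (hQsurj : Function.Surjective εQ)
    (hQexact0 : Function.Exact (dQ 0) εQ)
    (hQexact : ∀ n, Function.Exact (dQ (n + 1)) (dQ n))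
    -- the total complex T = P ⊗ Q over (A⊗B)^e
    (T : ℕ → Type) [∀ n, AddCommGroup (T n)] [∀ n, Module (Env R (A ⊗[R] B)) (T n)]
    [∀ n, Module R (T n)] [∀ n, IsScalarTower R (Env R (A ⊗[R] B)) (T n)]
    (t : ∀ n, T n ≃ₗ[R] ⨁ (ij : TotIdx n), (P ij.1.1 ⊗[R] Q ij.1.2))
    (dT : ∀ n, T (n + 1) →ₗ[Env R (A ⊗[R] B)] T n)
    (εT : T 0 →ₗ[Env R (A ⊗[R] B)] (A ⊗[R] B))
    -- the (A⊗B)^e ≅ A^e ⊗ B^e action on T is the componentwise one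
    (hTact : ∀ (n i j : ℕ) (h : i + j = n) (p : P i) (q : Q j) (a : A) (b : B)
        (a₂ : A) (b₂ : B),
      (((a ⊗ₜ[R] b) ⊗ₜ[R] (MulOpposite.op (a₂ ⊗ₜ[R] b₂)) : Env R (A ⊗[R] B)) •
          ((t n).symm (DirectSum.of (fun ij : TotIdx n => P ij.1.1 ⊗[R] Q ij.1.2)
            ⟨(i, j), h⟩ (p ⊗ₜ[R] q))))
        = (t n).symm (DirectSum.of (fun ij : TotIdx n => P ij.1.1 ⊗[R] Q ij.1.2)
            ⟨(i, j), h⟩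
            ((((a ⊗ₜ[R] MulOpposite.op a₂ : Env R A) • p) : P i)
              ⊗ₜ[R] (((b ⊗ₜ[R] MulOpposite.op b₂ : Env R B) • q) : Q j))))
    -- the differential of T is the total differential d⊗1 + (−1)^deg 1⊗d
    (hdT : ∀ (n i j : ℕ) (h : (i + 1) + (j + 1) = n + 1) (p : P (i + 1)) (q : Q (j + 1)),
      t n (dT n ((t (n + 1)).symm (DirectSum.of _ ⟨(i + 1, j + 1), h⟩ (p ⊗ₜ[R] q))))
        = DirectSum.of (fun ij : TotIdx n => P ij.1.1 ⊗[R] Q ij.1.2)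
            ⟨(i, j + 1), by omega⟩ ((dP i p) ⊗ₜ[R] q)
          + ((-1 : ℤ) ^ (i + 1)) •
            DirectSum.of (fun ij : TotIdx n => P ij.1.1 ⊗[R] Q ij.1.2)
              ⟨(i + 1, j), by omega⟩ (p ⊗ₜ[R] (dQ j q)))
    (hdT0 : ∀ (n : ℕ) (p : P 0) (q : Q (n + 1)),
      t n (dT n ((t (n + 1)).symm (DirectSum.of _ ⟨(0, n + 1), by omega⟩ (p ⊗ₜ[R] q))))
        = DirectSum.of (fun ij : TotIdx n => P ij.1.1 ⊗[R] Q ij.1.2)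
            ⟨(0, n), by omega⟩ (p ⊗ₜ[R] (dQ n q)))
    (hdTn : ∀ (n : ℕ) (p : P (n + 1)) (q : Q 0),
      t n (dT n ((t (n + 1)).symm (DirectSum.of _ ⟨(n + 1, 0), by omega⟩ (p ⊗ₜ[R] q))))
        = DirectSum.of (fun ij : TotIdx n => P ij.1.1 ⊗[R] Q ij.1.2)
            ⟨(n, 0), by omega⟩ ((dP n p) ⊗ₜ[R] q))
    -- the augmentation of T is εP ⊗ εQ
    (hεT : ∀ (p : P 0) (q : Q 0),
      εT ((t 0).symm (DirectSum.of (fun ij : TotIdx 0 => P ij.1.1 ⊗[R] Q ij.1.2)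
          ⟨(0, 0), rfl⟩ (p ⊗ₜ[R] q)))
        = (εP p) ⊗ₜ[R] (εQ q)) :
    -- conclusion: T → A⊗B is a projective resolution over (A⊗B)^e
    Function.Surjective εT ∧
    Function.Exact (dT 0) εT ∧
    (∀ n, Function.Exact (dT (n + 1)) (dT n)) ∧
    (∀ n, Module.Projective (Env R (A ⊗[R] B)) (T n)) := by
  have hAe := env_proj R A hRA
  have hBe := env_proj R B hRB
  have := env_tower R A
  have := env_tower R B
  have := env_tower R (A ⊗[R] B)
  obtain ⟨k1, k2, k3⟩ := tot_exact R P Q hRA hRB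
    (fun n => proj_restrict R (Env R A) (P n) (hPproj n))
    (fun n => proj_restrict R (Env R B) (Q n) (hQproj n))
    (fun n => (dP n).restrictScalars R) (εP.restrictScalars R) hPsurj hPexact0 hPexact
    (fun n => (dQ n).restrictScalars R) (εQ.restrictScalars R) hQsurj hQexact0 hQexact
    (fun n => (t n).toLinearMap ∘ₗ (dT n).restrictScalars R ∘ₗ (t (n + 1)).symm.toLinearMap)
    (εT.restrictScalars R ∘ₗ (t 0).symm.toLinearMap)
    (fun n i j h p q => hdT n i j h p q)
    (fun n j h p q => by
      obtain rfl : j = n := by omega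
      exact hdT0 j p q)
    (fun n i h p q => by
      obtain rfl : i = n := by omega
      exact hdTn i p q)
    hεT
  refine ⟨?_, ?_, ?_, ?_⟩
  · intro z
    obtain ⟨w, hw⟩ := k1 z
    exact ⟨_, hw⟩
  · intro z
    have := k2 (t 0 z)
    simp only [LinearMap.comp_apply, LinearEquiv.coe_coe, LinearEquiv.symm_apply_apply,
      LinearMap.restrictScalars_apply, Set.mem_range] at this
    rw [this]
    constructor
    · rintro ⟨w, hw⟩
      exact ⟨_, (t 0).injective hw⟩
    · rintro ⟨w, rfl⟩
      exact ⟨t 1 w, by simp⟩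
  · intro n z
    have := k3 n (t (n + 1) z)
    simp only [LinearMap.comp_apply, LinearEquiv.coe_coe, LinearEquiv.symm_apply_apply,
      LinearMap.restrictScalars_apply, Set.mem_range, LinearEquiv.map_eq_zero_iff] at this
    rw [this]
    constructor
    · rintro ⟨w, hw⟩
      exact ⟨_, (t (n + 1)).injective hw⟩
    · rintro ⟨w, rfl⟩
      exact ⟨t (n + 1 + 1) w, by simp⟩
  · intro n
    exact tot_proj R A B P Q hPproj hQproj n (T n) (t n) (hTact n)

end
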